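/- Let D=(V,A) be a strong semicomplete multipartite digraph with at least two vertices and let X ⊆ V be a set of vertices lying in pairwise distinct color classes. Then D contains a directed cycle C with X ⊆ V(C). -/

import Mathlib

open Set

variable {V : Type*}

/-- `p` is a directed path (nonempty, vertices pairwise distinct, consecutive
vertices joined by arcs of `A`) all of whose vertices lie in `S`. -/
def IsPathOn (A : V → V → Prop) (S : Set V) (p : List V) : Prop :=
  p ≠ [] ∧ p.Nodup ∧ p.Chain' A ∧ ∀ v ∈ p, v ∈ S

/-- `p` is a directed path within `S` starting at `x` and ending at `y`. -/
def IsPathFromTo (A : V → V → Prop) (S : Set V) (p : List V) (x y : V) : Prop :=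
  IsPathOn A S p ∧ p.head? = some x ∧ p.getLast? = some y

/-- The subdigraph induced on `S` is strong. -/
def StrongOn (A : V → V → Prop) (S : Set V) : Prop :=
  ∀ x ∈ S, ∀ y ∈ S, x ≠ y → ∃ p, IsPathFromTo A S p x y

/-- The subdigraph induced on `S` is `k`-strong: it has at least `k+1` vertices and
remains strong after deleting any set of at most `k-1` vertices. -/
def KStrongOn (A : V → V → Prop) (k : ℕ) (S : Set V) : Prop :=
  k + 1 ≤ S.ncard ∧ ∀ X : Set V, X ⊆ S → X.ncard ≤ k - 1 → StrongOn A (S \ X)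

/-- In a semicomplete multipartite digraph, two vertices lie in the same color class
iff they are equal or there is no arc between them in either direction. -/
def SameClass (A : V → V → Prop) (u v : V) : Prop :=
  u = v ∨ (¬ A u v ∧ ¬ A v u)

/-- `A` is (the arc relation of) a semicomplete multipartite digraph: it is loopless
and the "same color class" relation is transitive (hence an equivalence relation whose
classes are the color classes: within a class there are no arcs, and between any two
vertices of different classes there is at least one arc). -/
def IsSMD (A : V → V → Prop) : Prop :=
  (∀ v, ¬ A v v) ∧
  ∀ u v w, SameClass A u v → SameClass A v w → SameClass A u w

/-- A digraph is unilaterally connected if any two distinct vertices are joined by a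
directed path in one direction or the other. -/
def Unilateral (A : V → V → Prop) : Prop :=
  ∀ x y : V, x ≠ y →
    (∃ p, IsPathFromTo A Set.univ p x y) ∨ (∃ p, IsPathFromTo A Set.univ p y x)

/-- The independence number of a semicomplete multipartite digraph: the maximum size
of a color class. -/
noncomputable def indepNum [Fintype V] (A : V → V → Prop) : ℕ :=
  Finset.univ.sup fun v : V => {u | SameClass A v u}.ncard

/-- `X` is a 2-separator of `x` and `y`: at most two vertices, avoiding `x` and `y`,
whose removal destroys all `(x,y)`-paths. -/
def IsTwoSep (A : V → V → Prop) (x y : V) (X : Set V) : Prop :=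
  X ⊆ ({x, y} : Set V)ᶜ ∧ X.ncard ≤ 2 ∧ ¬ ∃ p, IsPathFromTo A Xᶜ p x y

/-- A separator of `x` and `y` is trivial if it contains all out-neighbors of `x`
or all in-neighbors of `y`. -/
def IsTrivialSep (A : V → V → Prop) (x y : V) (X : Set V) : Prop :=
  {w | A x w} ⊆ X ∨ {w | A w y} ⊆ X

/-- `T` is a strong component of the subdigraph induced on `S`: a maximal subset of
`S` inducing a strong subdigraph. -/
def IsStrongComponentOn (A : V → V → Prop) (S T : Set V) : Prop :=
  T ⊆ S ∧ StrongOn A T ∧ ∀ U : Set V, T ⊆ U → U ⊆ S → StrongOn A U → U = T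

/-- `R 0, …, R (k-1)` is the linear decomposition of the subdigraph induced on `S`:
an ordered partition of `S` into nonempty sets, each of which is a strong component
of the subdigraph induced on `S` or a subset of a single color class, with no arc
from a later part to an earlier one and at least one arc between consecutive parts. -/
def IsLinearDecompOn (A : V → V → Prop) (S : Set V) (k : ℕ) (R : Fin k → Set V) : Prop :=
  (∀ i, (R i).Nonempty ∧ R i ⊆ S) ∧
  (∀ v ∈ S, ∃! i, v ∈ R i) ∧
  (∀ i, IsStrongComponentOn A S (R i) ∨ ∃ v, R i ⊆ {u | SameClass A v u}) ∧
  (∀ i j : Fin k, i < j → ∀ a ∈ R j, ∀ b ∈ R i, ¬ A a b) ∧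
  (∀ i : Fin k, ∀ h : (i : ℕ) + 1 < k, ∃ a ∈ R i, ∃ b ∈ R ⟨(i : ℕ) + 1, h⟩, A a b)

/-- The digraph with arc relation `B` contains a directed cycle. -/
def HasCycle (B : V → V → Prop) : Prop :=
  ∃ c : List V, 2 ≤ c.length ∧ c.Nodup ∧ c.Chain' B ∧
    ∃ a b, c.head? = some a ∧ c.getLast? = some b ∧ B b a

/-- The list `v :: m` traverses a directed cycle of `A`. -/
def IsCyc (A : V → V → Prop) (v : V) (m : List V) : Prop :=
  (v :: m).Nodup ∧ (v :: (m ++ [v])).IsChain A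

lemma SameClass.symm {A : V → V → Prop} {u v : V} (h : SameClass A u v) : SameClass A v u := by
  unfold SameClass at *
  tauto

lemma not_sameClass_of_arc {A : V → V → Prop} (hA : IsSMD A) {u v : V} (h : A u v) :
    ¬ SameClass A u v := by
  rintro (rfl | h')
  · exact hA.1 _ h
  · exact h'.1 h

lemma List.exists_first {P : V → Prop} {l : List V} {b : V} (hb : b ∈ l) (hP : P b) :
    ∃ l₁ a l₂, l = l₁ ++ a :: l₂ ∧ P a ∧ ∀ w ∈ l₁, ¬ P w := by
  induction l with
  | nil => simp at hb
  | cons c l ih =>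
    by_cases hc : P c
    · exact ⟨[], c, l, rfl, hc, by simp⟩
    · have hbl : b ∈ l := by
        rcases List.mem_cons.1 hb with rfl | h
        · exact absurd hP hc
        · exact h
      obtain ⟨l₁, a, l₂, rfl, ha, h⟩ := ih hbl
      refine ⟨c :: l₁, a, l₂, rfl, ha, ?_⟩
      simpa [hc] using h

lemma IsCyc.rotate {A : V → V → Prop} {u v : V} {s t : List V} (h : IsCyc A u (s ++ v :: t)) :
    IsCyc A v (t ++ u :: s) := by
  obtain ⟨hn, hc⟩ := h
  refine ⟨?_, ?_⟩
  · have hp : (v :: (t ++ u :: s)).Perm (u :: (s ++ v :: t)) :=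
      (List.perm_append_comm (l₁ := v :: t) (l₂ := u :: s))
    exact hp.nodup_iff.2 hn
  · have h1 : ((u :: s) ++ v :: (t ++ [u])).IsChain A := by simpa using hc
    rw [List.isChain_split] at h1
    have h2 : ((v :: t) ++ u :: (s ++ [v])).IsChain A :=
      List.isChain_split.2 ⟨by simpa using h1.2, by simpa using h1.1⟩
    simpa using h2

lemma IsCyc.exists_of_mem {A : V → V → Prop} {u v : V} {m : List V} (h : IsCyc A u m)
    (hv : v ∈ u :: m) : ∃ m', IsCyc A v m' ∧ ∀ w, w ∈ v :: m' ↔ w ∈ u :: m := by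
  rcases List.mem_cons.1 hv with rfl | hv
  · exact ⟨m, h, fun _ => Iff.rfl⟩
  · obtain ⟨s, t, rfl⟩ := List.append_of_mem hv
    refine ⟨t ++ u :: s, h.rotate, fun w => ?_⟩
    simp only [List.mem_cons, List.mem_append]
    tauto

lemma IsCyc.flip {A : V → V → Prop} {u : V} {m : List V} (h : IsCyc A u m) :
    IsCyc (flip A) u m.reverse := by
  refine ⟨?_, ?_⟩
  · simpa using h.1
  · have := h.2
    rw [← List.reverse_reverse (u :: (m ++ [u])), List.isChain_reverse] at this
    have h' : (u :: (m ++ [u])).reverse.IsChain (_root_.flip A) := this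
    simpa using h'

lemma IsSMD.flip {A : V → V → Prop} (hA : IsSMD A) : IsSMD (flip A) := by
  have h : ∀ u v, SameClass (_root_.flip A) u v ↔ SameClass A u v := by
    intro u v
    unfold SameClass _root_.flip
    tauto
  refine ⟨hA.1, fun u v w => ?_⟩
  simpa only [h] using hA.2 u v w

/-- A walk starting at an in-neighbor of `x` and having no out-neighbor of `x` afterwards can be
redirected into `x`, losing at most one vertex, which lies in the color class of `x`. -/
lemma exists_chain_into {A : V → V → Prop} (hA : IsSMD A) {v x : V} {m : List V}
    (hc : (v :: m).IsChain A) (hv : A v x) (hm : ∀ w ∈ m, ¬ A x w) :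
    ∃ m', m'.Sublist m ∧ (v :: (m' ++ [x])).IsChain A ∧ ∀ w ∈ m, w ∈ m' ∨ SameClass A x w := by
  rcases List.eq_nil_or_concat m with rfl | ⟨r, z, rfl⟩
  · exact ⟨[], List.Sublist.refl _, by simpa using hv, by simp⟩
  simp only [List.concat_eq_append] at *
  by_cases hz : A z x
  · refine ⟨r ++ [z], List.Sublist.refl _, ?_, fun w hw => Or.inl hw⟩
    have : ((v :: r) ++ z :: [x]).IsChain A :=
      List.isChain_split.2 ⟨by simpa using hc, by simpa using hz⟩
    simpa using this
  · have hxz : SameClass A x z := Or.inr ⟨hm z (by simp), hz⟩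
    refine ⟨r, by simp, ?_, fun w hw => ?_⟩
    · obtain ⟨r', y, hr⟩ : ∃ r' y, v :: r = r' ++ [y] := by
        rcases List.eq_nil_or_concat (v :: r) with h | ⟨r', y, h⟩
        · simp at h
        · exact ⟨r', y, by simpa using h⟩
      have hc' : (r' ++ y :: [z]).IsChain A := by
        have : ((v :: r) ++ [z]).IsChain A := by simpa using hc
        rw [hr] at this
        simpa using this
      rw [List.isChain_split] at hc'
      have hyz : A y z := by simpa using hc'.2
      have hyx : A y x := by
        have hy : y ∈ v :: r := by simp [hr]
        rcases List.mem_cons.1 hy with rfl | hy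
        · exact hv
        · by_contra hyx
          exact not_sameClass_of_arc hA hyz
            (hA.2 _ _ _ (Or.inr ⟨hyx, hm y (by simp [hy])⟩) hxz)
      have : (r' ++ y :: [x]).IsChain A := List.isChain_split.2 ⟨hc'.1, by simpa using hyx⟩
      have h2 : ((v :: r) ++ [x]).IsChain A := by
        rw [hr]
        simpa using this
      simpa using h2
    · rcases List.mem_append.1 hw with h | h
      · exact Or.inl h
      · rw [List.mem_singleton.1 h]
        exact Or.inr hxz

lemma IsCyc.extend_of_arc {A : V → V → Prop} (hA : IsSMD A) {u v x : V} {c : List V}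
    (hC : IsCyc A u c) (hx : x ∉ u :: c) (hv : v ∈ u :: c) (hvx : A v x)
    {q : List V} {y : V} (hq : q.Nodup) (hqc : q.IsChain A) (hqx : q.head? = some x)
    (hqy : y ∈ q) (hy : y ∈ u :: c) :
    ∃ v' m', IsCyc A v' m' ∧ x ∈ v' :: m' ∧ ∀ w ∈ u :: c, w ∈ v' :: m' ∨ SameClass A x w := by
  obtain ⟨m, hm, hmem⟩ := hC.exists_of_mem hv
  simp only [← hmem] at hx hy ⊢
  clear hmem hC hv
  set S : V → Prop := fun a => ∃ p : List V, (x :: p).Nodup ∧ (x :: (p ++ [a])).IsChain A ∧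
    ∀ w ∈ p, w ∉ v :: m with hS
  have hSarc : ∀ w, A x w → S w := fun w hw => ⟨[], by simp, by simpa using hw, by simp⟩
  obtain ⟨b, hb, hSb⟩ : ∃ b ∈ m ++ [v], S b := by
    obtain ⟨l₁, a, l₂, rfl, ha, hl⟩ := List.exists_first (P := (· ∈ v :: m)) hqy hy
    obtain ⟨p, rfl⟩ : ∃ p, l₁ = x :: p := by
      cases l₁ with
      | nil =>
        simp only [List.nil_append, List.head?_cons, Option.some.injEq] at hqx
        exact absurd (hqx ▸ ha) hx
      | cons z p =>
        simp only [List.cons_append, List.head?_cons, Option.some.injEq] at hqx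
        exact ⟨p, by rw [hqx]⟩
    refine ⟨a, ?_, p, (List.nodup_append.1 hq).1, ?_, fun w hw => hl w (by simp [hw])⟩
    · simp only [List.mem_cons, List.mem_append, List.not_mem_nil, or_false] at ha ⊢
      tauto
    · simpa using (List.isChain_split.1 hqc).1
  obtain ⟨m₁, a, m₂, hmv, ⟨p, hpn, hpc, hp⟩, hm₁⟩ := List.exists_first hb hSb
  obtain ⟨n, hn⟩ : ∃ n, a :: m₂ = n ++ [v] := by
    rcases List.eq_nil_or_concat (a :: m₂) with h | ⟨n, z, h⟩
    · simp at h
    · rw [List.concat_eq_append] at h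
      rw [h, ← List.append_assoc] at hmv
      have := List.append_inj_right' hmv rfl
      exact ⟨n, by rw [h, this]⟩
  have hmn : m = m₁ ++ n := by
    rw [hn, ← List.append_assoc] at hmv
    exact List.append_inj_left' hmv rfl
  have hch : ((v :: m₁) ++ a :: m₂).IsChain A := by
    have := hm.2
    rw [hmv] at this
    simpa using this
  have hch₁ : (v :: m₁).IsChain A := (List.isChain_append.1 hch).1
  have hch₂ : (a :: m₂).IsChain A := (List.isChain_append.1 hch).2.1
  obtain ⟨m', hsub, hc', hm'⟩ := exists_chain_into hA hch₁ hvx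
    (fun w hw h => hm₁ w hw (hSarc w h))
  refine ⟨x, p ++ (n ++ v :: m'), ⟨?_, ?_⟩, by simp, ?_⟩
  · have h1 : (n ++ v :: m').Nodup := by
      have h2 : (n ++ v :: m₁).Nodup := by
        have h3 : (n ++ v :: m₁).Perm (v :: m) := by
          rw [hmn]
          exact List.perm_append_comm (l₁ := n) (l₂ := v :: m₁)
        exact h3.nodup_iff.2 hm.1
      exact h2.sublist ((hsub.cons_cons v).append_left n)
    have h4 : ∀ w ∈ n ++ v :: m', w ∈ v :: m := by
      intro w hw
      rw [hmn]
      simp only [List.mem_append, List.mem_cons] at hw ⊢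
      rcases hw with h | h | h
      · simp [h]
      · simp [h]
      · simp [hsub.subset h]
    rw [← List.cons_append, List.nodup_append]
    refine ⟨hpn, h1, ?_⟩
    rintro s hs t ht rfl
    rcases List.mem_cons.1 hs with rfl | hs
    · exact hx (h4 _ ht)
    · exact hp _ hs (h4 _ ht)
  · have h1 : ((x :: p) ++ a :: m₂).IsChain A :=
      List.isChain_split.2 ⟨by simpa using hpc, hch₂⟩
    rw [hn] at h1
    have h2 : ((x :: p ++ n) ++ v :: (m' ++ [x])).IsChain A :=
      List.isChain_split.2 ⟨by simpa using h1, hc'⟩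
    simpa using h2
  · intro w hw
    rw [hmn] at hw
    simp only [List.mem_cons, List.mem_append] at hw ⊢
    rcases hw with h | h | h
    · tauto
    · have := hm' w h
      tauto
    · tauto

lemma IsCyc.extend {A : V → V → Prop} (hA : IsSMD A) (hstrong : StrongOn A Set.univ)
    {u x : V} {c : List V} (hC : IsCyc A u c) (hx : x ∉ u :: c) :
    ∃ v' m', IsCyc A v' m' ∧ x ∈ v' :: m' ∧ ∀ w ∈ u :: c, w ∈ v' :: m' ∨ SameClass A x w := by
  have hxu : x ≠ u := fun h => hx (by simp [h])
  obtain ⟨v, hv, hvx⟩ : ∃ v ∈ u :: c, ¬ SameClass A x v := by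
    by_contra! hall
    cases c with
    | nil => exact hA.1 u (by simpa using hC.2)
    | cons w c =>
      have huw : A u w := by
        have := hC.2
        simp only [List.cons_append, List.isChain_cons_cons] at this
        exact this.1
      exact not_sameClass_of_arc hA huw
        (hA.2 _ _ _ (hall u (by simp)).symm (hall w (by simp)))
  by_cases hvx' : A v x
  · obtain ⟨q, ⟨-, hq, hqc, -⟩, hqx, hqy⟩ := hstrong x trivial u trivial hxu
    exact hC.extend_of_arc hA hx hv hvx' hq hqc hqx (List.mem_of_getLast? hqy) (by simp)
  · have hxv : A x v := by
      unfold SameClass at hvx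
      tauto
    obtain ⟨q, ⟨-, hq, hqc, -⟩, hqx, hqy⟩ := hstrong u trivial x trivial hxu.symm
    obtain ⟨v', m', h1, h2, h3⟩ := hC.flip.extend_of_arc (x := x) (v := v) (y := u)
      (q := q.reverse) hA.flip (by simpa using hx) (by simpa using hv) hxv (by simpa using hq)
      (List.isChain_reverse.2 hqc) (by simpa using hqy)
      (by simpa using List.mem_of_head? hqx) (by simp)
    refine ⟨v', m'.reverse, h1.flip, by simpa using h2, fun w hw => ?_⟩
    have := h3 w (by simpa using hw)
    simp only [SameClass, _root_.flip, List.mem_cons, List.mem_reverse] at this ⊢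
    tauto

lemma exists_isCyc {A : V → V → Prop} (hA : IsSMD A) (hstrong : StrongOn A Set.univ)
    [Nontrivial V] : ∃ v m, IsCyc A v m := by
  obtain ⟨u, v, huv⟩ := exists_pair_ne V
  obtain ⟨p, ⟨-, -, hpc, -⟩, hpu, hpv⟩ := hstrong u trivial v trivial huv
  obtain ⟨b, hub⟩ : ∃ b, A u b := by
    match p with
    | [] => simp at hpu
    | [z] => simp_all
    | z :: b :: l =>
      simp only [List.head?_cons, Option.some.injEq] at hpu
      exact ⟨b, hpu ▸ (List.isChain_cons_cons.1 hpc).1⟩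
  have hbu : b ≠ u := by
    rintro rfl
    exact hA.1 _ hub
  obtain ⟨q, ⟨-, hq, hqc, -⟩, hqb, hqu⟩ := hstrong b trivial u trivial hbu
  cases q with
  | nil => simp at hqb
  | cons z l =>
    simp only [List.head?_cons, Option.some.injEq] at hqb
    subst hqb
    refine ⟨z, l, hq, ?_⟩
    rw [← List.cons_append, List.isChain_append]
    refine ⟨hqc, by simp, ?_⟩
    intro s hs t ht
    simp_all

lemma exists_isCyc_superset [Finite V] {A : V → V → Prop} (hA : IsSMD A)
    (hstrong : StrongOn A Set.univ) [Nontrivial V] (X : Set V)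
    (hX : ∀ a ∈ X, ∀ b ∈ X, SameClass A a b → a = b) :
    ∃ v m, IsCyc A v m ∧ ∀ x ∈ X, x ∈ v :: m := by
  induction X, Set.toFinite X using Set.Finite.induction_on with
  | empty =>
    obtain ⟨v, m, h⟩ := exists_isCyc hA hstrong
    exact ⟨v, m, h, by simp⟩
  | @insert x Y hxY _ ih =>
    obtain ⟨v, m, h, hY⟩ := ih fun a ha b hb => hX a (Or.inr ha) b (Or.inr hb)
    by_cases hx : x ∈ v :: m
    · refine ⟨v, m, h, ?_⟩
      rintro y (rfl | hy)
      · exact hx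
      · exact hY y hy
    · obtain ⟨v', m', h', hx', hk⟩ := h.extend hA hstrong hx
      refine ⟨v', m', h', ?_⟩
      rintro y (rfl | hy)
      · exact hx'
      · refine (hk y (hY y hy)).resolve_right fun hxy => hx ?_
        rw [hX x (Or.inl rfl) y (Or.inr hy) hxy]
        exact hY y hy

/-- In a strong SMD with at least two vertices, for every set `X` of
vertices from pairwise distinct color classes there is a directed cycle containing
`X`. -/
theorem stmt_12 {V : Type*} [Fintype V] (A : V → V → Prop) (hSMD : IsSMD A)
    (hstrong : StrongOn A (Set.univ : Set V)) (hcard : 2 ≤ Fintype.card V)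
    (X : Set V) (hXdist : ∀ a ∈ X, ∀ b ∈ X, SameClass A a b → a = b) :
    ∃ c : List V, 2 ≤ c.length ∧ c.Nodup ∧ c.Chain' A ∧
      (∃ a b, c.head? = some a ∧ c.getLast? = some b ∧ A b a) ∧
      ∀ x ∈ X, x ∈ c := by
  have : Nontrivial V := Fintype.one_lt_card_iff_nontrivial.1 hcard
  obtain ⟨v, m, ⟨hn, hc⟩, hX⟩ := exists_isCyc_superset hSMD hstrong X hXdist
  rw [← List.cons_append, List.isChain_append] at hc
  have hl : (v :: m).getLast? = some ((v :: m).getLast (by simp)) :=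
    List.getLast?_eq_some_getLast _
  have hlast := hc.2.2 _ hl v (by simp)
  refine ⟨v :: m, ?_, hn, hc.1, ⟨v, _, rfl, hl, hlast⟩, hX⟩
  cases m with
  | nil => exact absurd hlast (hSMD.1 v)
  | cons _ _ => simp
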